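/- arXiv:1810.04999 — 4 statements merged into one kernel-verified Lean document; each statement's English description precedes it below -/
import Mathlib

section
/- Let S be a commutative ring, let (F,∂) and (G,d) be chain complexes of S-modules indexed by the natural numbers such that every F_n is a projective S-module and H_n(G) = 0 for all n ≥ 1. Let f ∈ S, let σ be a homotopy for f on F, let τ be a homotopy for f on G, let φ : F → G be a morphism of chain complexes, and let N be an S-module with f·N = 0. Then for every n ≥ 0 the maps (φ_{n+1}∘σ_n)⊗id_N and (τ_n∘φ_n)⊗id_N from F_n⊗_S N to G_{n+1}⊗_S N both carry ker(∂_n⊗id_N) into ker(d_{n+1}⊗id_N) and carry im(∂_{n+1}⊗id_N) into im(d_{n+2}⊗id_N), and the two induced S-linear maps H_n(F⊗N) → H_{n+1}(G⊗N) are equal. -/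
open LinearMap

theorem Module.exists_comp_eq_of_exact {S P A B C : Type*} [CommRing S]
    [AddCommGroup P] [Module S P] [AddCommGroup A] [Module S A]
    [AddCommGroup B] [Module S B] [AddCommGroup C] [Module S C] [Module.Projective S P]
    (d : A →ₗ[S] B) (e : B →ₗ[S] C) (hde : ker e ≤ range d)
    (g : P →ₗ[S] B) (hg : e.comp g = 0) : ∃ h : P →ₗ[S] A, d.comp h = g := by
  obtain ⟨h, hh⟩ := Module.projective_lifting_property d.rangeRestrict
    (g.codRestrict (range d) fun x => hde (LinearMap.congr_fun hg x)) d.surjective_rangeRestrict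
  exact ⟨h, LinearMap.ext fun x => congrArg Subtype.val (LinearMap.congr_fun hh x)⟩

theorem LinearMap.rTensor_smul_eq_zero_of_annihilates {S P Q : Type*} [CommRing S]
    [AddCommGroup P] [Module S P] [AddCommGroup Q] [Module S Q]
    {N : Type*} [AddCommGroup N] [Module S N] {f : S} (hN : ∀ x : N, f • x = 0)
    (g : P →ₗ[S] Q) : rTensor N (f • g) = 0 :=
  TensorProduct.ext' fun x y => by
    rw [rTensor_tmul, LinearMap.smul_apply, TensorProduct.smul_tmul, hN, TensorProduct.tmul_zero,
      LinearMap.zero_apply]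

/-- A degree-one family which is a homotopy for `f • φ` anticommutes with the differentials
after tensoring with a module killed by `f`. -/
theorem LinearMap.rTensor_anticomm_of_annihilates {S P Q R T : Type*} [CommRing S]
    [AddCommGroup P] [Module S P] [AddCommGroup Q] [Module S Q]
    [AddCommGroup R] [Module S R] [AddCommGroup T] [Module S T]
    {N : Type*} [AddCommGroup N] [Module S N] {f : S} (hN : ∀ x : N, f • x = 0)
    {d : Q →ₗ[S] R} {b : P →ₗ[S] Q} {a : T →ₗ[S] R} {e : P →ₗ[S] T} {g : P →ₗ[S] R}
    (h : d.comp b + a.comp e = f • g) (x : TensorProduct S P N) :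
    rTensor N d (rTensor N b x) = -rTensor N a (rTensor N e x) := by
  have key := LinearMap.congr_fun (congrArg (rTensor N) h) x
  rw [rTensor_smul_eq_zero_of_annihilates hN, rTensor_add, rTensor_comp, rTensor_comp] at key
  exact eq_neg_of_add_eq_zero_left key

/-- A degree-one family anticommuting with the differentials, from a complex of projectives to
a complex exact in positive degrees, is null-homotopic in each degree. -/
theorem LinearMap.exists_nullHomotopy_of_anticomm {S : Type*} [CommRing S] {F G : ℕ → Type*}
    [∀ n, AddCommGroup (F n)] [∀ n, Module S (F n)]
    [∀ n, AddCommGroup (G n)] [∀ n, Module S (G n)]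
    (dF : ∀ n, F (n + 1) →ₗ[S] F n) (dG : ∀ n, G (n + 1) →ₗ[S] G n)
    (hdF : ∀ n, (dF n).comp (dF (n + 1)) = 0)
    (hFproj : ∀ n, Module.Projective S (F n))
    (hGexact : ∀ n, ker (dG n) ≤ range (dG (n + 1)))
    (α : ∀ n, F n →ₗ[S] G (n + 1))
    (hα0 : (dG 0).comp (α 0) = 0)
    (hα : ∀ n, (dG (n + 1)).comp (α (n + 1)) + (α n).comp (dF n) = 0) :
    (∃ h : F 0 →ₗ[S] G 2, (dG 1).comp h = α 0) ∧
    ∀ n, ∃ (h : F n →ₗ[S] G (n + 2)) (k : F (n + 1) →ₗ[S] G (n + 3)),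
      (dG (n + 2)).comp k = α (n + 1) + h.comp (dF n) := by
  have h_zero : ∃ h : F 0 →ₗ[S] G 2, (dG 1).comp h = α 0 :=
    Module.exists_comp_eq_of_exact (dG 1) (dG 0) (hGexact 0) (α 0) hα0
  have lift_succ : ∀ n (h : F n →ₗ[S] G (n + 2)),
      ((dG (n + 1)).comp h).comp (dF n) = (α n).comp (dF n) →
      ∃ k : F (n + 1) →ₗ[S] G (n + 3), (dG (n + 2)).comp k = α (n + 1) + h.comp (dF n) := by
    intro n h hh
    refine Module.exists_comp_eq_of_exact (dG (n + 2)) (dG (n + 1)) (hGexact (n + 1)) _ ?_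
    rw [comp_add, ← comp_assoc, hh, hα n]
  have lift : ∀ n, ∃ h : F n →ₗ[S] G (n + 2),
      ((dG (n + 1)).comp h).comp (dF n) = (α n).comp (dF n) := by
    intro n
    induction n with
    | zero =>
      obtain ⟨h, hh⟩ := h_zero
      exact ⟨h, by rw [hh]⟩
    | succ n ih =>
      obtain ⟨h, hh⟩ := ih
      obtain ⟨k, hk⟩ := lift_succ n h hh
      exact ⟨k, by rw [hk, add_comp, comp_assoc, hdF, comp_zero, add_zero]⟩
  refine ⟨h_zero, fun n => ?_⟩
  obtain ⟨h, hh⟩ := lift n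
  exact ⟨h, lift_succ n h hh⟩

/-- With `F`, `G`, homotopies `σ`, `τ` for `f`, and a chain map `φ` as in
Statement 0, and an `S`-module `N` with `f·N = 0`, for every `n ≥ 0` the maps
`(φ_{n+1}∘σ_n)⊗id_N` and `(τ_n∘φ_n)⊗id_N : F_n⊗N → G_{n+1}⊗N` carry cycles to cycles and
boundaries to boundaries, and the two induced maps `H_n(F⊗N) → H_{n+1}(G⊗N)` are equal
(their difference carries cycles into boundaries). -/
theorem stmt1
    {S : Type*} [CommRing S]
    (F G : ℕ → Type*)
    [∀ n, AddCommGroup (F n)] [∀ n, Module S (F n)]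
    [∀ n, AddCommGroup (G n)] [∀ n, Module S (G n)]
    (dF : ∀ n, F (n + 1) →ₗ[S] F n) (dG : ∀ n, G (n + 1) →ₗ[S] G n)
    (hdF : ∀ n, (dF n).comp (dF (n + 1)) = 0)
    (hdG : ∀ n, (dG n).comp (dG (n + 1)) = 0)
    (hFproj : ∀ n, Module.Projective S (F n))
    (hGexact : ∀ n, LinearMap.ker (dG n) ≤ LinearMap.range (dG (n + 1)))
    (f : S)
    (σ : ∀ n, F n →ₗ[S] F (n + 1)) (τ : ∀ n, G n →ₗ[S] G (n + 1))
    (hσ0 : (dF 0).comp (σ 0) = f • (LinearMap.id : F 0 →ₗ[S] F 0))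
    (hσ : ∀ n, (dF (n + 1)).comp (σ (n + 1)) + (σ n).comp (dF n)
        = f • (LinearMap.id : F (n + 1) →ₗ[S] F (n + 1)))
    (hτ0 : (dG 0).comp (τ 0) = f • (LinearMap.id : G 0 →ₗ[S] G 0))
    (hτ : ∀ n, (dG (n + 1)).comp (τ (n + 1)) + (τ n).comp (dG n)
        = f • (LinearMap.id : G (n + 1) →ₗ[S] G (n + 1)))
    (φ : ∀ n, F n →ₗ[S] G n)
    (hφ : ∀ n, (dG n).comp (φ (n + 1)) = (φ n).comp (dF n))
    (N : Type*) [AddCommGroup N] [Module S N]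
    (hN : ∀ x : N, f • x = 0) :
    -- cycles are carried to cycles (degree 0, where every element of `F 0 ⊗ N` is a cycle)
    (∀ x : TensorProduct S (F 0) N,
        rTensor N ((φ 1).comp (σ 0)) x ∈ ker (rTensor N (dG 0)) ∧
        rTensor N ((τ 0).comp (φ 0)) x ∈ ker (rTensor N (dG 0))) ∧
    -- cycles are carried to cycles (positive degrees)
    (∀ n, ∀ x ∈ ker (rTensor N (dF n)),
        rTensor N ((φ (n + 2)).comp (σ (n + 1))) x ∈ ker (rTensor N (dG (n + 1))) ∧
        rTensor N ((τ (n + 1)).comp (φ (n + 1))) x ∈ ker (rTensor N (dG (n + 1)))) ∧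
    -- boundaries are carried to boundaries
    (∀ n, ∀ x ∈ range (rTensor N (dF n)),
        rTensor N ((φ (n + 1)).comp (σ n)) x ∈ range (rTensor N (dG (n + 1))) ∧
        rTensor N ((τ n).comp (φ n)) x ∈ range (rTensor N (dG (n + 1)))) ∧
    -- the two induced maps on homology agree (degree 0)
    (∀ x : TensorProduct S (F 0) N,
        rTensor N ((φ 1).comp (σ 0)) x - rTensor N ((τ 0).comp (φ 0)) x
          ∈ range (rTensor N (dG 1))) ∧
    -- the two induced maps on homology agree (positive degrees)
    (∀ n, ∀ x ∈ ker (rTensor N (dF n)),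
        rTensor N ((φ (n + 2)).comp (σ (n + 1))) x
            - rTensor N ((τ (n + 1)).comp (φ (n + 1))) x
          ∈ range (rTensor N (dG (n + 2)))) := by
  have hA0 : (dG 0).comp ((φ 1).comp (σ 0)) = f • φ 0 := by
    rw [← comp_assoc, hφ, comp_assoc, hσ0, comp_smul, comp_id]
  have hB0 : (dG 0).comp ((τ 0).comp (φ 0)) = f • φ 0 := by
    rw [← comp_assoc, hτ0, smul_comp, id_comp]
  have hA : ∀ n, (dG (n + 1)).comp ((φ (n + 2)).comp (σ (n + 1)))
      + ((φ (n + 1)).comp (σ n)).comp (dF n) = f • φ (n + 1) := by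
    intro n
    rw [← comp_assoc, hφ, comp_assoc, comp_assoc, ← comp_add, hσ, comp_smul, comp_id]
  have hB : ∀ n, (dG (n + 1)).comp ((τ (n + 1)).comp (φ (n + 1)))
      + ((τ n).comp (φ n)).comp (dF n) = f • φ (n + 1) := by
    intro n
    rw [comp_assoc, ← hφ, ← comp_assoc, ← comp_assoc, ← add_comp, hτ, smul_comp, id_comp]
  obtain ⟨h_zero, h_succ⟩ := exists_nullHomotopy_of_anticomm dF dG hdF hFproj hGexact
    (fun n => (φ (n + 1)).comp (σ n) - (τ n).comp (φ n))
    (by rw [comp_sub, hA0, hB0, sub_self])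
    (fun n => by rw [comp_sub, sub_comp, sub_add_sub_comm, hA, hB, sub_self])
  refine ⟨fun x => ⟨?_, ?_⟩, fun n x hx => ⟨?_, ?_⟩, ?_, fun x => ?_, fun n x hx => ?_⟩
  · rw [mem_ker, ← rTensor_comp_apply, hA0, rTensor_smul_eq_zero_of_annihilates hN, LinearMap.zero_apply]
  · rw [mem_ker, ← rTensor_comp_apply, hB0, rTensor_smul_eq_zero_of_annihilates hN, LinearMap.zero_apply]
  · rw [mem_ker, rTensor_anticomm_of_annihilates hN (hA n), mem_ker.mp hx, map_zero, neg_zero]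
  · rw [mem_ker, rTensor_anticomm_of_annihilates hN (hB n), mem_ker.mp hx, map_zero, neg_zero]
  · rintro n _ ⟨y, rfl⟩
    refine ⟨⟨-rTensor N ((φ (n + 2)).comp (σ (n + 1))) y, ?_⟩,
      ⟨-rTensor N ((τ (n + 1)).comp (φ (n + 1))) y, ?_⟩⟩
    · rw [map_neg, rTensor_anticomm_of_annihilates hN (hA n), neg_neg]
    · rw [map_neg, rTensor_anticomm_of_annihilates hN (hB n), neg_neg]
  · obtain ⟨h, hh⟩ := h_zero
    exact ⟨rTensor N h x, by rw [← rTensor_comp_apply, hh, rTensor_sub, LinearMap.sub_apply]⟩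
  · obtain ⟨h, k, hk⟩ := h_succ n
    refine ⟨rTensor N k x, ?_⟩
    rw [← rTensor_comp_apply, hk, rTensor_add, LinearMap.add_apply, rTensor_comp_apply, mem_ker.mp hx,
      map_zero, add_zero, rTensor_sub, LinearMap.sub_apply]
end

section
/- Let S be a commutative ring, let (F,∂) be a chain complex of S-modules indexed by the natural numbers with every F_n projective and H_n(F) = 0 for all n ≥ 1, let f ∈ S, let σ and σ' be two homotopies for f on F, and let N be an S-module with f·N = 0. Then for every n ≥ 0 the maps H_n(F⊗N) → H_{n+1}(F⊗N) induced by σ_n⊗id_N and by σ'_n⊗id_N coincide. (In particular, the operators induced on the homology of F⊗N by homotopies for f are independent of the choice of homotopy.) -/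
open LinearMap

/-- A map from a projective module whose image lies in the range of `g` factors through `g`. -/
theorem exists_comp_eq_of_range_le {S P A B : Type*} [CommRing S]
    [AddCommGroup P] [Module S P] [AddCommGroup A] [Module S A] [AddCommGroup B] [Module S B]
    [Module.Projective S P] (g : A →ₗ[S] B) (h : P →ₗ[S] B) (hr : ∀ x, h x ∈ range g) :
    ∃ t : P →ₗ[S] A, g.comp t = h := by
  obtain ⟨t, ht⟩ := Module.projective_lifting_property g.rangeRestrict (h.codRestrict _ hr)
    g.surjective_rangeRestrict
  refine ⟨t, LinearMap.ext fun x => ?_⟩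
  simpa using congrArg Subtype.val (LinearMap.congr_fun ht x)

/-- A degree-one map anticommuting with the differential of a complex of projectives that is exact
in positive degrees is null-homotopic. -/
theorem exists_nullHomotopy_of_anticommute {S : Type*} [CommRing S] (F : ℕ → Type*)
    [∀ n, AddCommGroup (F n)] [∀ n, Module S (F n)]
    (d : ∀ n, F (n + 1) →ₗ[S] F n)
    (hd : ∀ n, (d n).comp (d (n + 1)) = 0)
    (hproj : ∀ n, Module.Projective S (F n))
    (hexact : ∀ n, ker (d n) ≤ range (d (n + 1)))
    (δ : ∀ n, F n →ₗ[S] F (n + 1))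
    (hδ0 : (d 0).comp (δ 0) = 0)
    (hδ : ∀ n, (d (n + 1)).comp (δ (n + 1)) + (δ n).comp (d n) = 0) :
    (∃ t : F 0 →ₗ[S] F 2, (d 1).comp t = δ 0) ∧
    ∀ n, ∃ (t : F n →ₗ[S] F (n + 2)) (t' : F (n + 1) →ₗ[S] F (n + 3)),
      (d (n + 2)).comp t' = δ (n + 1) + t.comp (d n) := by
  have h0 : ∃ t : F 0 →ₗ[S] F 2, (d 1).comp t = δ 0 :=
    exists_comp_eq_of_range_le _ _ fun x => hexact 0 (LinearMap.congr_fun hδ0 x)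
  have lift (n : ℕ) (t : F n →ₗ[S] F (n + 2))
      (ht : ((d (n + 1)).comp t).comp (d n) = (δ n).comp (d n)) :
      ∃ t' : F (n + 1) →ₗ[S] F (n + 3), (d (n + 2)).comp t' = δ (n + 1) + t.comp (d n) := by
    refine exists_comp_eq_of_range_le _ _ fun x => hexact (n + 1) ?_
    have h₁ := LinearMap.congr_fun (hδ n) x
    have h₂ := LinearMap.congr_fun ht x
    simp only [LinearMap.add_apply, LinearMap.comp_apply, LinearMap.zero_apply] at h₁ h₂
    simp only [mem_ker, LinearMap.add_apply, LinearMap.comp_apply, map_add, h₂, h₁]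
  have key (n : ℕ) : ∃ t : F n →ₗ[S] F (n + 2),
      ((d (n + 1)).comp t).comp (d n) = (δ n).comp (d n) := by
    induction n with
    | zero =>
      obtain ⟨t, ht⟩ := h0
      exact ⟨t, by rw [← ht]⟩
    | succ n ih =>
      obtain ⟨t, ht⟩ := ih
      obtain ⟨t', ht'⟩ := lift n t ht
      refine ⟨t', ?_⟩
      rw [ht', LinearMap.add_comp, LinearMap.comp_assoc, hd, LinearMap.comp_zero, add_zero]
  refine ⟨h0, fun n => ?_⟩
  obtain ⟨t, ht⟩ := key n
  exact ⟨t, lift n t ht⟩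

/-- If `(F, ∂)` is a chain complex of projective `S`-modules, exact in positive
degrees, `σ` and `σ'` are two homotopies for `f` on `F`, and `N` is an `S`-module with
`f·N = 0`, then the maps `H_n(F⊗N) → H_{n+1}(F⊗N)` induced by `σ_n⊗id_N` and by `σ'_n⊗id_N`
coincide: on cycles the difference has values in boundaries. -/
theorem stmt3
    {S : Type*} [CommRing S]
    (F : ℕ → Type*)
    [∀ n, AddCommGroup (F n)] [∀ n, Module S (F n)]
    (dF : ∀ n, F (n + 1) →ₗ[S] F n)
    (hdF : ∀ n, (dF n).comp (dF (n + 1)) = 0)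
    (hFproj : ∀ n, Module.Projective S (F n))
    (hFexact : ∀ n, LinearMap.ker (dF n) ≤ LinearMap.range (dF (n + 1)))
    (f : S)
    (σ σ' : ∀ n, F n →ₗ[S] F (n + 1))
    (hσ0 : (dF 0).comp (σ 0) = f • (LinearMap.id : F 0 →ₗ[S] F 0))
    (hσ : ∀ n, (dF (n + 1)).comp (σ (n + 1)) + (σ n).comp (dF n)
        = f • (LinearMap.id : F (n + 1) →ₗ[S] F (n + 1)))
    (hσ'0 : (dF 0).comp (σ' 0) = f • (LinearMap.id : F 0 →ₗ[S] F 0))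
    (hσ' : ∀ n, (dF (n + 1)).comp (σ' (n + 1)) + (σ' n).comp (dF n)
        = f • (LinearMap.id : F (n + 1) →ₗ[S] F (n + 1)))
    (N : Type*) [AddCommGroup N] [Module S N]
    (hN : ∀ x : N, f • x = 0) :
    -- degree 0 (every element of `F 0 ⊗ N` is a cycle)
    (∀ x : TensorProduct S (F 0) N,
        rTensor N (σ 0) x - rTensor N (σ' 0) x ∈ range (rTensor N (dF 1))) ∧
    -- positive degrees
    (∀ n, ∀ x ∈ ker (rTensor N (dF n)),
        rTensor N (σ (n + 1)) x - rTensor N (σ' (n + 1)) x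
          ∈ range (rTensor N (dF (n + 2)))) := by
  obtain ⟨⟨t, ht⟩, h⟩ := exists_nullHomotopy_of_anticommute F dF hdF hFproj hFexact
    (fun n => σ n - σ' n)
    (by rw [LinearMap.comp_sub, hσ0, hσ'0, sub_self])
    (fun n => by
      rw [LinearMap.comp_sub, LinearMap.sub_comp, sub_add_sub_comm, hσ, hσ', sub_self])
  constructor
  · intro x
    refine ⟨rTensor N t x, ?_⟩
    rw [← LinearMap.comp_apply, ← rTensor_comp, ht, rTensor_sub, LinearMap.sub_apply]
  · intro n x hx
    obtain ⟨t, t', ht⟩ := h n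
    refine ⟨rTensor N t' x, ?_⟩
    rw [← LinearMap.comp_apply, ← rTensor_comp, ht, rTensor_add, rTensor_sub, rTensor_comp,
      LinearMap.add_apply, LinearMap.sub_apply, LinearMap.comp_apply, mem_ker.mp hx, map_zero,
      add_zero]
end

section
/- Let S be a commutative ring, let (F,∂) and (G,d) be chain complexes of S-modules indexed by the natural numbers such that every F_n is a projective S-module and H_n(G) = 0 for all n ≥ 1. Let f ∈ S, let σ be a homotopy for f on F, let τ be a homotopy for f on G, let φ : F → G be a morphism of chain complexes, and let N be an S-module with f·N = 0. Then: (1) Hom_S(σ_n, N)∘Hom_S(∂_{n+1}, N) + Hom_S(∂_{n+1}, N)∘Hom_S(σ_{n+1}, N) = 0, so the maps Hom_S(σ_n, N) : Hom_S(F_{n+1},N) → Hom_S(F_n,N) carry cocycles to cocycles and coboundaries to coboundaries and induce S-linear maps H^{n+1}(Hom(F,N)) → H^n(Hom(F,N)), and similarly for τ on Hom(G,N); and (2) the maps Hom_S(φ_{n+1}∘σ_n, N) and Hom_S(τ_n∘φ_n, N) from Hom_S(G_{n+1},N) to Hom_S(F_n,N) carry cocycles to cocycles and coboundaries to coboundaries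 and induce equal S-linear maps H^{n+1}(Hom(G,N)) → H^n(Hom(F,N)). -/
open LinearMap

theorem Module.Projective.exists_comp_eq_of_range_le {S P M M' : Type*} [CommRing S]
    [AddCommGroup P] [Module S P] [AddCommGroup M] [Module S M] [AddCommGroup M'] [Module S M']
    [Module.Projective S P] (d : M' →ₗ[S] M) (u : P →ₗ[S] M)
    (h : LinearMap.range u ≤ LinearMap.range d) : ∃ v : P →ₗ[S] M', d.comp v = u := by
  obtain ⟨v, hv⟩ := Module.projective_lifting_property d.rangeRestrict
    (u.codRestrict (LinearMap.range d) fun x => h ⟨x, rfl⟩) d.surjective_rangeRestrict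
  exact ⟨v, LinearMap.ext fun x => congrArg Subtype.val (LinearMap.congr_fun hv x)⟩

/-- A family `u n : F n → G (n + 1)` anticommuting with the differentials, from a complex of
projective modules to a complex exact in positive degrees, is null-homotopic. -/
theorem exists_nullHomotopy_of_anticommute_s4 {S : Type*} [CommRing S] {F G : ℕ → Type*}
    [∀ n, AddCommGroup (F n)] [∀ n, Module S (F n)]
    [∀ n, AddCommGroup (G n)] [∀ n, Module S (G n)]
    (dF : ∀ n, F (n + 1) →ₗ[S] F n) (dG : ∀ n, G (n + 1) →ₗ[S] G n)
    (hdF : ∀ n, (dF n).comp (dF (n + 1)) = 0)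
    (hFproj : ∀ n, Module.Projective S (F n))
    (hGexact : ∀ n, LinearMap.ker (dG n) ≤ LinearMap.range (dG (n + 1)))
    (u : ∀ n, F n →ₗ[S] G (n + 1)) (hu0 : (dG 0).comp (u 0) = 0)
    (hu : ∀ n, (dG (n + 1)).comp (u (n + 1)) + (u n).comp (dF n) = 0) :
    (∃ h : F 0 →ₗ[S] G 2, (dG 1).comp h = u 0) ∧
    ∀ n, ∃ (h : F n →ₗ[S] G (n + 2)) (k : F (n + 1) →ₗ[S] G (n + 3)),
      (dG (n + 2)).comp k = u (n + 1) + h.comp (dF n) := by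
  have lift (n : ℕ) (w : F n →ₗ[S] G (n + 1)) (hw : (dG n).comp w = 0) :
      ∃ h : F n →ₗ[S] G (n + 2), (dG (n + 1)).comp h = w := by
    have := hFproj n
    exact Module.Projective.exists_comp_eq_of_range_le _ _
      ((LinearMap.range_le_ker_iff.mpr hw).trans (hGexact n))
  have zero := lift 0 (u 0) hu0
  refine ⟨zero, fun n => ?_⟩
  induction n with
  | zero =>
    obtain ⟨h, hh⟩ := zero
    refine ⟨h, lift 1 _ ?_⟩
    rw [LinearMap.comp_add, ← LinearMap.comp_assoc, hh, hu]
  | succ n ih =>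
    obtain ⟨h, k, hk⟩ := ih
    refine ⟨k, lift (n + 2) _ ?_⟩
    rw [LinearMap.comp_add, ← LinearMap.comp_assoc, hk, LinearMap.add_comp,
      LinearMap.comp_assoc, hdF, LinearMap.comp_zero, add_zero, hu]

section DualHomotopy

variable {S : Type*} [CommRing S] {F : ℕ → Type*}
  [∀ n, AddCommGroup (F n)] [∀ n, Module S (F n)]
  {d : ∀ n, F (n + 1) →ₗ[S] F n} {f : S} {σ : ∀ n, F n →ₗ[S] F (n + 1)}
  {N : Type*} [AddCommGroup N] [Module S N]

theorem lcomp_homotopy_zero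
    (hσ0 : (d 0).comp (σ 0) = f • (LinearMap.id : F 0 →ₗ[S] F 0)) (hN : ∀ x : N, f • x = 0) :
    (lcomp S N (σ 0)).comp (lcomp S N (d 0)) = 0 := by
  ext g x
  have := LinearMap.congr_fun hσ0 x
  simp only [LinearMap.comp_apply, LinearMap.smul_apply, LinearMap.id_apply] at this
  simp [this, hN]

theorem lcomp_homotopy_succ
    (hσ : ∀ n, (d (n + 1)).comp (σ (n + 1)) + (σ n).comp (d n)
      = f • (LinearMap.id : F (n + 1) →ₗ[S] F (n + 1))) (hN : ∀ x : N, f • x = 0) (n : ℕ) :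
    (lcomp S N (σ (n + 1))).comp (lcomp S N (d (n + 1)))
      + (lcomp S N (d n)).comp (lcomp S N (σ n)) = 0 := by
  ext g x
  have := congrArg g (LinearMap.congr_fun (hσ n) x)
  simpa [hN] using this

theorem lcomp_homotopy_mem_ker
    (hσ : ∀ n, (lcomp S N (σ (n + 1))).comp (lcomp S N (d (n + 1)))
      + (lcomp S N (d n)).comp (lcomp S N (σ n)) = 0)
    (n : ℕ) {g : F (n + 1) →ₗ[S] N} (hg : g ∈ ker (lcomp S N (d (n + 1)))) :
    lcomp S N (σ n) g ∈ ker (lcomp S N (d n)) := by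
  have := LinearMap.congr_fun (hσ n) g
  rw [LinearMap.mem_ker] at hg ⊢
  simpa only [LinearMap.add_apply, LinearMap.comp_apply, hg, map_zero, zero_add,
    LinearMap.zero_apply] using this

theorem lcomp_homotopy_mem_range
    (hσ : ∀ n, (lcomp S N (σ (n + 1))).comp (lcomp S N (d (n + 1)))
      + (lcomp S N (d n)).comp (lcomp S N (σ n)) = 0)
    (n : ℕ) {g : F (n + 2) →ₗ[S] N} (hg : g ∈ range (lcomp S N (d (n + 1)))) :
    lcomp S N (σ (n + 1)) g ∈ range (lcomp S N (d n)) := by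
  obtain ⟨g, rfl⟩ := hg
  refine ⟨-lcomp S N (σ n) g, ?_⟩
  rw [map_neg]
  exact (eq_neg_of_add_eq_zero_left (LinearMap.congr_fun (hσ n) g)).symm

end DualHomotopy

section DualChainMap

variable {S : Type*} [CommRing S] {F G : ℕ → Type*}
  [∀ n, AddCommGroup (F n)] [∀ n, Module S (F n)]
  [∀ n, AddCommGroup (G n)] [∀ n, Module S (G n)]
  {dF : ∀ n, F (n + 1) →ₗ[S] F n} {dG : ∀ n, G (n + 1) →ₗ[S] G n} {φ : ∀ n, F n →ₗ[S] G n}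
  {N : Type*} [AddCommGroup N] [Module S N]

theorem lcomp_chainMap_comm (hφ : ∀ n, (dG n).comp (φ (n + 1)) = (φ n).comp (dF n))
    (n : ℕ) (g : G n →ₗ[S] N) :
    lcomp S N (φ (n + 1)) (lcomp S N (dG n) g) = lcomp S N (dF n) (lcomp S N (φ n) g) :=
  LinearMap.ext fun x => congrArg g (LinearMap.congr_fun (hφ n) x)

theorem lcomp_chainMap_mem_ker (hφ : ∀ n, (dG n).comp (φ (n + 1)) = (φ n).comp (dF n))
    (n : ℕ) {g : G n →ₗ[S] N} (hg : g ∈ ker (lcomp S N (dG n))) :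
    lcomp S N (φ n) g ∈ ker (lcomp S N (dF n)) := by
  rw [LinearMap.mem_ker] at hg ⊢
  rw [← lcomp_chainMap_comm hφ, hg, map_zero]

theorem lcomp_chainMap_mem_range (hφ : ∀ n, (dG n).comp (φ (n + 1)) = (φ n).comp (dF n))
    (n : ℕ) {g : G (n + 1) →ₗ[S] N} (hg : g ∈ range (lcomp S N (dG n))) :
    lcomp S N (φ (n + 1)) g ∈ range (lcomp S N (dF n)) := by
  obtain ⟨g, rfl⟩ := hg
  exact ⟨_, (lcomp_chainMap_comm hφ n g).symm⟩

end DualChainMap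

/-- With `F`, `G`, homotopies `σ`, `τ` for `f`, a chain map `φ`, and an
`S`-module `N` with `f·N = 0` as in Statement 0: (1) the duals `Hom(σ_n, N)` anticommute with
the cochain differentials of `Hom(F,N)`, carry cocycles to cocycles and coboundaries to
coboundaries (and similarly for `τ` on `Hom(G,N)`); (2) the maps `Hom(φ_{n+1}∘σ_n, N)` and
`Hom(τ_n∘φ_n, N)` carry cocycles to cocycles and coboundaries to coboundaries, and induce
equal maps `H^{n+1}(Hom(G,N)) → H^n(Hom(F,N))`.  Here `Hom(g, N) = lcomp S N g` is
precomposition with `g`, and the cochain differential on `Hom(F,N)` in degree `n` is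
`lcomp S N (dF n) : (F n →ₗ N) →ₗ (F (n+1) →ₗ N)` (so coboundaries in degree `0` are `0`). -/
theorem stmt4
    {S : Type*} [CommRing S]
    (F G : ℕ → Type*)
    [∀ n, AddCommGroup (F n)] [∀ n, Module S (F n)]
    [∀ n, AddCommGroup (G n)] [∀ n, Module S (G n)]
    (dF : ∀ n, F (n + 1) →ₗ[S] F n) (dG : ∀ n, G (n + 1) →ₗ[S] G n)
    (hdF : ∀ n, (dF n).comp (dF (n + 1)) = 0)
    (hdG : ∀ n, (dG n).comp (dG (n + 1)) = 0)
    (hFproj : ∀ n, Module.Projective S (F n))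
    (hGexact : ∀ n, LinearMap.ker (dG n) ≤ LinearMap.range (dG (n + 1)))
    (f : S)
    (σ : ∀ n, F n →ₗ[S] F (n + 1)) (τ : ∀ n, G n →ₗ[S] G (n + 1))
    (hσ0 : (dF 0).comp (σ 0) = f • (LinearMap.id : F 0 →ₗ[S] F 0))
    (hσ : ∀ n, (dF (n + 1)).comp (σ (n + 1)) + (σ n).comp (dF n)
        = f • (LinearMap.id : F (n + 1) →ₗ[S] F (n + 1)))
    (hτ0 : (dG 0).comp (τ 0) = f • (LinearMap.id : G 0 →ₗ[S] G 0))
    (hτ : ∀ n, (dG (n + 1)).comp (τ (n + 1)) + (τ n).comp (dG n)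
        = f • (LinearMap.id : G (n + 1) →ₗ[S] G (n + 1)))
    (φ : ∀ n, F n →ₗ[S] G n)
    (hφ : ∀ n, (dG n).comp (φ (n + 1)) = (φ n).comp (dF n))
    (N : Type*) [AddCommGroup N] [Module S N]
    (hN : ∀ x : N, f • x = 0) :
    -- (1) the dualized homotopy identities (using `f·N = 0`)
    ((lcomp S N (σ 0)).comp (lcomp S N (dF 0)) = 0) ∧
    (∀ n, (lcomp S N (σ (n + 1))).comp (lcomp S N (dF (n + 1)))
        + (lcomp S N (dF n)).comp (lcomp S N (σ n)) = 0) ∧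
    ((lcomp S N (τ 0)).comp (lcomp S N (dG 0)) = 0) ∧
    (∀ n, (lcomp S N (τ (n + 1))).comp (lcomp S N (dG (n + 1)))
        + (lcomp S N (dG n)).comp (lcomp S N (τ n)) = 0) ∧
    -- (1) `Hom(σ_n, N)` carries cocycles to cocycles
    (∀ n, ∀ g ∈ ker (lcomp S N (dF (n + 1))), lcomp S N (σ n) g ∈ ker (lcomp S N (dF n))) ∧
    -- (1) `Hom(σ_n, N)` carries coboundaries to coboundaries
    (∀ g ∈ range (lcomp S N (dF 0)), lcomp S N (σ 0) g = 0) ∧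
    (∀ n, ∀ g ∈ range (lcomp S N (dF (n + 1))),
        lcomp S N (σ (n + 1)) g ∈ range (lcomp S N (dF n))) ∧
    -- (1) likewise for `τ` on `Hom(G,N)`
    (∀ n, ∀ g ∈ ker (lcomp S N (dG (n + 1))), lcomp S N (τ n) g ∈ ker (lcomp S N (dG n))) ∧
    (∀ g ∈ range (lcomp S N (dG 0)), lcomp S N (τ 0) g = 0) ∧
    (∀ n, ∀ g ∈ range (lcomp S N (dG (n + 1))),
        lcomp S N (τ (n + 1)) g ∈ range (lcomp S N (dG n))) ∧
    -- (2) cocycles are carried to cocycles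
    (∀ n, ∀ g ∈ ker (lcomp S N (dG (n + 1))),
        lcomp S N ((φ (n + 1)).comp (σ n)) g ∈ ker (lcomp S N (dF n)) ∧
        lcomp S N ((τ n).comp (φ n)) g ∈ ker (lcomp S N (dF n))) ∧
    -- (2) coboundaries are carried to coboundaries
    (∀ g ∈ range (lcomp S N (dG 0)),
        lcomp S N ((φ 1).comp (σ 0)) g = 0 ∧ lcomp S N ((τ 0).comp (φ 0)) g = 0) ∧
    (∀ n, ∀ g ∈ range (lcomp S N (dG (n + 1))),
        lcomp S N ((φ (n + 2)).comp (σ (n + 1))) g ∈ range (lcomp S N (dF n)) ∧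
        lcomp S N ((τ (n + 1)).comp (φ (n + 1))) g ∈ range (lcomp S N (dF n))) ∧
    -- (2) the two induced maps on cohomology agree
    (∀ g ∈ ker (lcomp S N (dG 1)),
        lcomp S N ((φ 1).comp (σ 0)) g = lcomp S N ((τ 0).comp (φ 0)) g) ∧
    (∀ n, ∀ g ∈ ker (lcomp S N (dG (n + 2))),
        lcomp S N ((φ (n + 2)).comp (σ (n + 1))) g
            - lcomp S N ((τ (n + 1)).comp (φ (n + 1))) g
          ∈ range (lcomp S N (dF n))) := by
  have F0 := lcomp_homotopy_zero hσ0 hN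
  have F1 := lcomp_homotopy_succ hσ hN
  have G0 := lcomp_homotopy_zero hτ0 hN
  have G1 := lcomp_homotopy_succ hτ hN
  have F0' : ∀ g ∈ range (lcomp S N (dF 0)), lcomp S N (σ 0) g = 0 := by
    rintro _ ⟨g, rfl⟩
    exact LinearMap.congr_fun F0 g
  have G0' : ∀ g ∈ range (lcomp S N (dG 0)), lcomp S N (τ 0) g = 0 := by
    rintro _ ⟨g, rfl⟩
    exact LinearMap.congr_fun G0 g
  obtain ⟨⟨h, hh⟩, H⟩ := exists_nullHomotopy_of_anticommute_s4 dF dG hdF hFproj hGexact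
    (fun n => (φ (n + 1)).comp (σ n) - (τ n).comp (φ n))
    (by
      rw [LinearMap.comp_sub, ← LinearMap.comp_assoc, ← LinearMap.comp_assoc, hφ, hτ0,
        LinearMap.comp_assoc, hσ0]
      ext x
      simp)
    (fun n => by
      ext x
      have e1 := LinearMap.congr_fun (hφ (n + 1)) (σ (n + 1) x)
      have e2 := LinearMap.congr_fun (hφ n) x
      have e3 := congrArg (φ (n + 1)) (LinearMap.congr_fun (hσ n) x)
      have e4 := LinearMap.congr_fun (hτ n) (φ (n + 1) x)
      simp only [LinearMap.comp_apply, LinearMap.add_apply, LinearMap.sub_apply, map_sub,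
        map_add, LinearMap.smul_apply, LinearMap.id_apply, map_smul,
        LinearMap.zero_apply] at e1 e2 e3 e4 ⊢
      rw [e1, ← e2, sub_add_sub_comm, e3, e4, sub_self])
  refine ⟨F0, F1, G0, G1, fun n g => lcomp_homotopy_mem_ker F1 n, F0',
    fun n g => lcomp_homotopy_mem_range F1 n, fun n g => lcomp_homotopy_mem_ker G1 n, G0',
    fun n g => lcomp_homotopy_mem_range G1 n, fun n g hg => ⟨?_, ?_⟩, fun g hg => ⟨?_, ?_⟩,
    fun n g hg => ⟨?_, ?_⟩, fun g hg => ?_, fun n g hg => ?_⟩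
  · exact lcomp_homotopy_mem_ker F1 n (lcomp_chainMap_mem_ker hφ (n + 1) hg)
  · exact lcomp_chainMap_mem_ker hφ n (lcomp_homotopy_mem_ker G1 n hg)
  · exact F0' _ (lcomp_chainMap_mem_range hφ 0 hg)
  · exact (congrArg (lcomp S N (φ 0)) (G0' g hg)).trans (map_zero _)
  · exact lcomp_homotopy_mem_range F1 n (lcomp_chainMap_mem_range hφ (n + 1) hg)
  · exact lcomp_chainMap_mem_range hφ n (lcomp_homotopy_mem_range G1 n hg)
  · ext x
    have e := congrArg g (LinearMap.congr_fun hh x)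
    have e' := LinearMap.congr_fun (LinearMap.mem_ker.mp hg) (h x)
    simp only [LinearMap.comp_apply, LinearMap.sub_apply, map_sub, lcomp_apply,
      LinearMap.zero_apply] at e e' ⊢
    exact sub_eq_zero.mp (e.symm.trans e')
  · obtain ⟨h, k, hk⟩ := H n
    refine ⟨-lcomp S N h g, ?_⟩
    ext x
    have e := congrArg g (LinearMap.congr_fun hk x)
    have e' := LinearMap.congr_fun (LinearMap.mem_ker.mp hg) (k x)
    simp only [LinearMap.comp_apply, LinearMap.sub_apply, LinearMap.add_apply, map_sub, map_add,
      map_neg, LinearMap.neg_apply, lcomp_apply, LinearMap.zero_apply] at e e' ⊢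
    exact (eq_neg_of_add_eq_zero_left (e.symm.trans e')).symm
end

section
/- Let S be a commutative ring, let f_1,…,f_c ∈ S be a regular sequence generating the ideal I, let K be the Koszul complex of f_1,…,f_c, and let (G_p)_{p≥0} be free S-modules with S-linear maps t_1' : G_p → G_{p−1} such that t_1'∘t_1'(G_p) ⊆ I·G_{p−2}. Let {t_i^{p,q}} and {u_i^{p,q}} be two systems of higher CI operators on G, both satisfying the equivariance condition (c) (for every i ≥ 1 and all p, q, r, ω ∈ ⋀^r(S^c), η ∈ K_q, g ∈ G_p: t_i^{p,q+r}(g⊗(ω∧η)) = (id⊗(ω∧−))(t_i^{p,q}(g⊗η)), and likewise for u). Suppose n ≥ 2 is such that t_i^{p,q} = u_i^{p,q} for all i < n and all p, q. Then t_n and u_n agree modulo I: the image of t_n^{p,q} − u_n^{p,q} is contained in I·(G_{p−n} ⊗_S K_{q+n−1}) for all p, q; that is, the reductions R⊗t_n and R⊗u_n over R = S/I coincide. -/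
open scoped TensorProduct
open DirectSum

noncomputable section

namespace TorExtCI

variable (S : Type*) [CommRing S] (c : ℕ)

/-- The `q`-th term `K_q = ⋀^q (S^c)` of the Koszul complex, as a submodule of the exterior
algebra of `S^c`. -/
abbrev KoszulTerm (q : ℕ) : Submodule S (ExteriorAlgebra S (Fin c → S)) :=
  ⋀[S]^q (Fin c → S)

/-- The `S`-linear form on `S^c` sending the `i`-th standard basis vector `e_i` to `f i`. -/
def koszulForm (f : Fin c → S) : Module.Dual S (Fin c → S) :=
  ∑ i, f i • LinearMap.proj i

theorem contractLeft_mem (f : Fin c → S) (q : ℕ) :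
    ∀ x ∈ KoszulTerm S c q,
      CliffordAlgebra.contractLeft (Q := (0 : QuadraticForm S (Fin c → S)))
        (koszulForm S c f) x ∈ KoszulTerm S c (q - 1) := by
  set d := koszulForm S c f with hd
  set p : Submodule S (ExteriorAlgebra S (Fin c → S)) :=
    LinearMap.range (ExteriorAlgebra.ι S (M := Fin c → S)) with hp
  have haux : ∀ x, x ∈ (p ^ 0 : Submodule S _) →
      CliffordAlgebra.contractLeft (Q := (0 : QuadraticForm S (Fin c → S))) d x = 0 := by
    intro x hx
    rw [pow_zero] at hx
    obtain ⟨r, rfl⟩ := Submodule.mem_one.mp hx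
    exact CliffordAlgebra.contractLeft_algebraMap _ _ _
  induction q with
  | zero =>
    intro x hx
    rw [haux x hx]
    exact zero_mem _
  | succ n ih =>
    intro x hx
    match n, ih with
    | 0, _ =>
      have hx' : x ∈ p := by rwa [← pow_one p]
      obtain ⟨v, rfl⟩ := hx'
      have : CliffordAlgebra.contractLeft (Q := (0 : QuadraticForm S (Fin c → S))) d
          (ExteriorAlgebra.ι S v) = algebraMap S _ (d v) :=
        CliffordAlgebra.contractLeft_ι _ _ _
      rw [this]
      exact Submodule.mem_one.mpr ⟨d v, rfl⟩
    | (m + 1), ih =>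
      have hx' : x ∈ p * p ^ (m + 1) := by rwa [← pow_succ'] 
      refine Submodule.mul_induction_on hx' ?_ ?_
      · rintro a ⟨v, rfl⟩ y hy
        rw [CliffordAlgebra.contractLeft_ι_mul]
        refine sub_mem ?_ ?_
        · exact Submodule.smul_mem _ _ hy
        · have h1 : CliffordAlgebra.contractLeft
              (Q := (0 : QuadraticForm S (Fin c → S))) d y ∈ p ^ m := ih y hy
          have : ExteriorAlgebra.ι S v * CliffordAlgebra.contractLeft
              (Q := (0 : QuadraticForm S (Fin c → S))) d y ∈ p * p ^ m :=
            Submodule.mul_mem_mul ⟨v, rfl⟩ h1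
          rwa [← pow_succ'] at this
      · intro y z hy hz
        rw [map_add]
        exact add_mem hy hz

/-- The Koszul differential `∂_q : K_q → K_{q−1}`, given by contraction against `koszulForm f`
(for `q = 0` this is the zero map `K_0 → K_0`). -/
def koszulD (f : Fin c → S) (q : ℕ) :
    KoszulTerm S c q →ₗ[S] KoszulTerm S c (q - 1) :=
  (CliffordAlgebra.contractLeft (Q := (0 : QuadraticForm S (Fin c → S)))
    (koszulForm S c f)).restrict (contractLeft_mem S c f q)

theorem wedge_mem (r q : ℕ) (ω : KoszulTerm S c r) :
    ∀ x ∈ KoszulTerm S c q,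
      (ω : ExteriorAlgebra S (Fin c → S)) * x ∈ KoszulTerm S c (r + q) := fun x hx => by
  have : (⋀[S]^(r+q) (Fin c → S)) = (⋀[S]^r (Fin c → S)) * (⋀[S]^q (Fin c → S)) := pow_add _ r q
  rw [KoszulTerm, this]
  exact Submodule.mul_mem_mul ω.2 hx

/-- Left exterior multiplication `K_q → K_{r+q}` by an element `ω ∈ K_r`. -/
def wedgeL (r q : ℕ) (ω : KoszulTerm S c r) :
    KoszulTerm S c q →ₗ[S] KoszulTerm S c (r + q) :=
  (LinearMap.mulLeft S (ω : ExteriorAlgebra S (Fin c → S))).restrict (wedge_mem S c r q ω)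

variable (G : ℕ → Type*) [∀ p, AddCommGroup (G p)] [∀ p, Module S (G p)]

/-- The direct sum `⨁_{p,q} G_p ⊗ K_q` housing all the bigraded pieces. -/
abbrev TotalModule := ⨁ (pq : ℕ × ℕ), (G pq.1 ⊗[S] ↥(KoszulTerm S c pq.2))

/-- Inclusion of the `(p,q)` component. -/
abbrev incl (p q : ℕ) : (G p ⊗[S] ↥(KoszulTerm S c q)) →ₗ[S] TotalModule S c G :=
  DirectSum.lof S (ℕ × ℕ) (fun pq => G pq.1 ⊗[S] ↥(KoszulTerm S c pq.2)) (p, q)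

/-- Projection onto the `(p,q)` component. -/
abbrev proj (p q : ℕ) : TotalModule S c G →ₗ[S] (G p ⊗[S] ↥(KoszulTerm S c q)) :=
  DirectSum.component S (ℕ × ℕ) (fun pq => G pq.1 ⊗[S] ↥(KoszulTerm S c pq.2)) (p, q)

/-- A system of higher CI operators on `G` (relative to the Koszul complex of `f`), encoded by
its total maps `T i` of bidegree `(−i, i−1)` on `⨁_{p,q} G_p ⊗ K_q`.  The component
`t_i^{p,q} : G_p ⊗ K_q → G_{p−i} ⊗ K_{q+i−1}` of `T i` is defined for `i ≤ p`; `T i` vanishes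
on the components with `p < i`.  Conditions `zeroth`, `first`, `quadratic` are conditions
(a), (b), (d) of the definition. -/
structure IsHigherCISystem (f : Fin c → S) (t1' : ∀ p, G (p + 1) →ₗ[S] G p)
    (T : ℕ → TotalModule S c G →ₗ[S] TotalModule S c G) : Prop where
  support : ∀ i p q, p < i → ∀ x : G p ⊗[S] ↥(KoszulTerm S c q),
    T i (incl S c G p q x) = 0
  bidegree : ∀ i p q, i ≤ p → ∀ x : G p ⊗[S] ↥(KoszulTerm S c q),
    T i (incl S c G p q x) ∈ LinearMap.range (incl S c G (p - i) (q + i - 1))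
  zeroth : ∀ p q (x : G p ⊗[S] ↥(KoszulTerm S c q)),
    T 0 (incl S c G p q x) =
      incl S c G p (q - 1) (((-1 : S) ^ p) • (LinearMap.lTensor (G p) (koszulD S c f q)) x)
  first : ∀ p q (x : G (p + 1) ⊗[S] ↥(KoszulTerm S c q)),
    T 1 (incl S c G (p + 1) q x) =
      incl S c G p q ((LinearMap.rTensor (↥(KoszulTerm S c q)) (t1' p)) x)
  quadratic : ∀ n, ∑ i ∈ Finset.range (n + 1), (T i).comp (T (n - i)) = 0

/-- Condition (c): the operators `t_i` (`i ≥ 1`) commute with the natural action of `⋀ S^c`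
on the Koszul complex, i.e. `t_i (g ⊗ (ω ∧ η)) = (id ⊗ (ω ∧ ·)) (t_i (g ⊗ η))`. -/
def EquivariantSystem (T : ℕ → TotalModule S c G →ₗ[S] TotalModule S c G) : Prop :=
  ∀ i, 1 ≤ i → ∀ p q r (ω : ↥(KoszulTerm S c r)) (g : G p) (η : ↥(KoszulTerm S c q)),
    T i (incl S c G p (r + q) (g ⊗ₜ[S] wedgeL S c r q ω η)) =
      incl S c G (p - i) (r + (q + i - 1))
        ((LinearMap.lTensor (G (p - i)) (wedgeL S c r (q + i - 1) ω))
          (proj S c G (p - i) (q + i - 1) (T i (incl S c G p q (g ⊗ₜ[S] η)))))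

/-- `f 0, …, f (c−1)` is a regular sequence: each `f j` is a nonzerodivisor modulo the
preceding ones, and `(f 0, …, f (c−1)) ≠ S`. -/
def IsRegularSeq {S : Type*} [CommRing S] {c : ℕ} (f : Fin c → S) : Prop :=
  (∀ j : Fin c, ∀ r : S,
      f j * r ∈ Ideal.span (f '' {i | i < j}) → r ∈ Ideal.span (f '' {i | i < j})) ∧
  Ideal.span (Set.range f) ≠ ⊤


/-- The `q`-th power of the span of `e_i`, `i < j`, inside the exterior algebra. -/
def truncTerm (j q : ℕ) : Submodule S (ExteriorAlgebra S (Fin c → S)) :=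
  ((Submodule.span S ((fun i : Fin c => Pi.single i (1 : S)) '' {i | i.val < j})).map
    (ExteriorAlgebra.ι S)) ^ q

/-- Contraction on the exterior algebra against a linear form. -/
abbrev contraction (d : Module.Dual S (Fin c → S)) :
    ExteriorAlgebra S (Fin c → S) →ₗ[S] ExteriorAlgebra S (Fin c → S) :=
  CliffordAlgebra.contractLeft (Q := (0 : QuadraticForm S (Fin c → S))) d

section Acyclicity

variable {S c}

theorem contraction_ι (d : Module.Dual S (Fin c → S)) (v : Fin c → S) :
    contraction S c d (ExteriorAlgebra.ι S v) = algebraMap S _ (d v) :=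
  CliffordAlgebra.contractLeft_ι _ _ _

theorem contraction_ι_mul (d : Module.Dual S (Fin c → S)) (v : Fin c → S)
    (x : ExteriorAlgebra S (Fin c → S)) :
    contraction S c d (ExteriorAlgebra.ι S v * x) =
      d v • x - ExteriorAlgebra.ι S v * contraction S c d x :=
  CliffordAlgebra.contractLeft_ι_mul _ _ _

theorem koszulForm_single (f : Fin c → S) (i : Fin c) :
    koszulForm S c f (Pi.single i 1) = f i := by
  simp [koszulForm, Pi.single_apply]

theorem truncTerm_mono {j k : ℕ} (h : j ≤ k) (q : ℕ) : truncTerm S c j q ≤ truncTerm S c k q := by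
  refine pow_le_pow_left' (Submodule.map_mono (Submodule.span_mono ?_)) q
  exact Set.image_mono fun i hi => lt_of_lt_of_le hi h

theorem truncTerm_top (q : ℕ) : truncTerm S c c q = KoszulTerm S c q := by
  have h : Submodule.span S
      ((fun i : Fin c => Pi.single i (1 : S)) '' {i | i.val < c}) = ⊤ := by
    have hu : {i : Fin c | i.val < c} = Set.univ := Set.eq_univ_of_forall fun i => i.2
    rw [hu, Set.image_univ, ← (Pi.basisFun S (Fin c)).span_eq]
    congr 1
    ext
    simp
  rw [truncTerm, h, Submodule.map_top]

theorem single_mul_mem_truncTerm {j : ℕ} (hj : j < c) {q : ℕ}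
    {x : ExteriorAlgebra S (Fin c → S)} (hx : x ∈ truncTerm S c j q) :
    ExteriorAlgebra.ι S (Pi.single ⟨j, hj⟩ (1 : S)) * x ∈ truncTerm S c (j + 1) (q + 1) := by
  rw [truncTerm, pow_succ']
  refine Submodule.mul_mem_mul ?_ (truncTerm_mono j.le_succ q hx)
  exact Submodule.mem_map_of_mem (Submodule.subset_span ⟨⟨j, hj⟩, j.lt_succ_self, rfl⟩)

theorem contraction_mem_truncTerm (d : Module.Dual S (Fin c → S)) (j q : ℕ) :
    ∀ x ∈ truncTerm S c j (q + 1), contraction S c d x ∈ truncTerm S c j q := by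
  induction q with
  | zero =>
    intro x hx
    rw [truncTerm, zero_add, pow_one] at hx
    obtain ⟨v, -, rfl⟩ := hx
    rw [contraction_ι, truncTerm, pow_zero]
    exact Submodule.mem_one.mpr ⟨_, rfl⟩
  | succ q ih =>
    intro x hx
    rw [truncTerm, pow_succ'] at hx
    refine Submodule.mul_induction_on hx ?_ ?_
    · rintro _ ⟨v, hv, rfl⟩ y hy
      rw [contraction_ι_mul]
      refine sub_mem (Submodule.smul_mem _ _ hy) ?_
      rw [truncTerm, pow_succ']
      exact Submodule.mul_mem_mul ⟨v, hv, rfl⟩ (ih y hy)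
    · intro y z hy hz
      rw [map_add]
      exact add_mem hy hz

theorem contraction_proj_eq_zero {j : ℕ} (hj : j < c) (q : ℕ) :
    ∀ x ∈ truncTerm S c j q, contraction S c (LinearMap.proj ⟨j, hj⟩) x = 0 := by
  have hv : ∀ v ∈ Submodule.span S ((fun i : Fin c => Pi.single i (1 : S)) '' {i | i.val < j}),
      v ⟨j, hj⟩ = 0 := by
    intro v hv
    induction hv using Submodule.span_induction with
    | mem v h =>
      obtain ⟨i, hi, rfl⟩ := h
      exact Pi.single_eq_of_ne (fun h => hi.ne (congrArg Fin.val h).symm) _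
    | zero => rfl
    | add v w _ _ h1 h2 => simp [h1, h2]
    | smul a v _ h => simp [h]
  induction q with
  | zero =>
    intro x hx
    rw [truncTerm, pow_zero] at hx
    obtain ⟨r, rfl⟩ := Submodule.mem_one.mp hx
    exact CliffordAlgebra.contractLeft_algebraMap _ _ _
  | succ q ih =>
    intro x hx
    rw [truncTerm, pow_succ'] at hx
    refine Submodule.mul_induction_on hx ?_ ?_
    · rintro _ ⟨v, hv', rfl⟩ y hy
      rw [contraction_ι_mul, ih y hy, LinearMap.proj_apply, hv v hv', zero_smul, mul_zero,
        sub_zero]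
    · intro y z hy hz
      rw [map_add, hy, hz, add_zero]

theorem exists_add_of_mem_span_succ {j : ℕ} (hj : j < c) {v : Fin c → S}
    (hv : v ∈ Submodule.span S
      ((fun i : Fin c => Pi.single i (1 : S)) '' {i | i.val < j + 1})) :
    ∃ w ∈ Submodule.span S ((fun i : Fin c => Pi.single i (1 : S)) '' {i | i.val < j}),
      ∃ r : S, v = w + r • Pi.single ⟨j, hj⟩ 1 := by
  induction hv using Submodule.span_induction with
  | mem v h =>
    obtain ⟨i, hi, rfl⟩ := h
    rcases Nat.lt_succ_iff_lt_or_eq.mp hi with h | h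
    · exact ⟨_, Submodule.subset_span ⟨i, h, rfl⟩, 0, by simp⟩
    · obtain rfl : i = ⟨j, hj⟩ := Fin.ext h
      exact ⟨0, zero_mem _, 1, by simp⟩
  | zero => exact ⟨0, zero_mem _, 0, by simp⟩
  | add _ _ _ _ h1 h2 =>
    obtain ⟨w, hw, r, rfl⟩ := h1
    obtain ⟨w', hw', r', rfl⟩ := h2
    exact ⟨w + w', add_mem hw hw', r + r', by module⟩
  | smul a _ _ h =>
    obtain ⟨w, hw, r, rfl⟩ := h
    exact ⟨a • w, Submodule.smul_mem _ _ hw, a * r, by module⟩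

theorem exists_decomposition {j : ℕ} (hj : j < c) (q : ℕ) :
    ∀ x ∈ truncTerm S c (j + 1) (q + 1), ∃ a ∈ truncTerm S c j (q + 1),
      ∃ b ∈ truncTerm S c j q,
        x = a + ExteriorAlgebra.ι S (Pi.single ⟨j, hj⟩ (1 : S)) * b := by
  induction q with
  | zero =>
    intro x hx
    rw [truncTerm, zero_add, pow_one] at hx
    obtain ⟨v, hv, rfl⟩ := hx
    obtain ⟨w, hw, r, rfl⟩ := exists_add_of_mem_span_succ hj hv
    refine ⟨ExteriorAlgebra.ι S w, ?_, algebraMap S _ r, ?_, ?_⟩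
    · rw [truncTerm, zero_add, pow_one]
      exact ⟨w, hw, rfl⟩
    · rw [truncTerm, pow_zero]
      exact Submodule.mem_one.mpr ⟨_, rfl⟩
    · rw [map_add, map_smul, Algebra.smul_def, Algebra.commutes]
  | succ q ih =>
    intro x hx
    rw [truncTerm, pow_succ'] at hx
    refine Submodule.mul_induction_on hx ?_ ?_
    · rintro _ ⟨v, hv, rfl⟩ y hy
      obtain ⟨a, ha, b, hb, rfl⟩ := ih y hy
      obtain ⟨w, hw, r, rfl⟩ := exists_add_of_mem_span_succ hj hv
      set e := ExteriorAlgebra.ι S (Pi.single ⟨j, hj⟩ 1 : Fin c → S) with he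
      have hee : e * e = 0 := ExteriorAlgebra.ι_sq_zero _
      have hwe : ExteriorAlgebra.ι S w * e = -(e * ExteriorAlgebra.ι S w) :=
        eq_neg_of_add_eq_zero_left (ExteriorAlgebra.ι_add_mul_swap _ _)
      have hmul : ∀ {k : ℕ} {z}, z ∈ truncTerm S c j k →
          ExteriorAlgebra.ι S w * z ∈ truncTerm S c j (k + 1) := by
        intro k z hz
        rw [truncTerm, pow_succ']
        exact Submodule.mul_mem_mul ⟨w, hw, rfl⟩ hz
      refine ⟨ExteriorAlgebra.ι S w * a, hmul ha, r • a - ExteriorAlgebra.ι S w * b,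
        sub_mem (Submodule.smul_mem _ _ ha) (hmul hb), ?_⟩
      calc ExteriorAlgebra.ι S (w + r • Pi.single ⟨j, hj⟩ 1) * (a + e * b)
          = ExteriorAlgebra.ι S w * a + (ExteriorAlgebra.ι S w * e) * b + r • (e * a)
            + r • ((e * e) * b) := by
            rw [map_add, map_smul, ← he]
            simp only [add_mul, mul_add, smul_mul_assoc, mul_assoc]
            abel
        _ = _ := by
            rw [hwe, hee]
            simp only [mul_sub, mul_smul_comm, neg_mul, zero_mul, smul_zero, mul_assoc]
            abel
    · rintro _ _ ⟨a, ha, b, hb, rfl⟩ ⟨a', ha', b', hb', rfl⟩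
      exact ⟨a + a', add_mem ha ha', b + b', add_mem hb hb', by rw [mul_add]; abel⟩

theorem map_koszulForm_span (f : Fin c → S) (j : ℕ) :
    (Submodule.span S ((fun i : Fin c => Pi.single i (1 : S)) '' {i | i.val < j})).map
      (koszulForm S c f) = Ideal.span (f '' {i | i.val < j}) := by
  rw [Submodule.map_span, ← Set.image_comp]
  congr 1
  exact Set.image_congr fun i _ => koszulForm_single f i

/-- The Koszul complex of a weakly regular sequence is acyclic in positive degrees, for every
initial segment of the sequence. -/
theorem exists_contraction_eq (f : Fin c → S)
    (hf : ∀ j : Fin c, ∀ r : S,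
      f j * r ∈ Ideal.span (f '' {i | i < j}) → r ∈ Ideal.span (f '' {i | i < j}))
    (j : ℕ) (hj : j ≤ c) :
    ∀ q, ∀ x ∈ truncTerm S c j (q + 1), contraction S c (koszulForm S c f) x = 0 →
      ∃ y ∈ truncTerm S c j (q + 2), contraction S c (koszulForm S c f) y = x := by
  set d := koszulForm S c f with hd
  induction j with
  | zero =>
    intro q x hx _
    have hx0 : x = 0 := by simpa [truncTerm] using hx
    exact ⟨0, zero_mem _, by rw [map_zero, hx0]⟩
  | succ j ih =>
    intro q x hx hdx
    have hjc : j < c := hj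
    specialize ih hjc.le
    obtain ⟨a, ha, b, hb, rfl⟩ := exists_decomposition hjc q x hx
    set e := ExteriorAlgebra.ι S (Pi.single ⟨j, hjc⟩ 1 : Fin c → S) with he
    have hde : ∀ z, contraction S c d (e * z) = f ⟨j, hjc⟩ • z - e * contraction S c d z := by
      intro z
      rw [he, contraction_ι_mul, hd, koszulForm_single]
    rw [map_add, hde] at hdx
    suffices hb' : ∃ b' ∈ truncTerm S c j (q + 1), contraction S c d b' = b by
      obtain ⟨b', hb'm, hb'⟩ := hb'
      have hdb : contraction S c d b = 0 := by
        rw [← hb']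
        exact CliffordAlgebra.contractLeft_contractLeft _ _
      obtain ⟨a', ha'm, ha'⟩ := ih q (a + f ⟨j, hjc⟩ • b')
        (add_mem ha (Submodule.smul_mem _ _ hb'm)) (by
          rw [map_add, map_smul, hb']
          rwa [hdb, mul_zero, sub_zero] at hdx)
      refine ⟨a' - e * b', sub_mem (truncTerm_mono j.le_succ _ ha'm)
        (single_mul_mem_truncTerm hjc hb'm), ?_⟩
      rw [map_sub, ha', hde, hb']
      abel
    cases q with
    | zero =>
      rw [truncTerm, pow_zero] at hb
      obtain ⟨r, rfl⟩ := Submodule.mem_one.mp hb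
      rw [truncTerm, zero_add, pow_one] at ha
      obtain ⟨v, hv, rfl⟩ := ha
      have h0 : contraction S c d (algebraMap S _ r) = 0 :=
        CliffordAlgebra.contractLeft_algebraMap _ _ _
      rw [h0, mul_zero, sub_zero, contraction_ι, Algebra.smul_def, ← map_mul, ← map_add] at hdx
      have h1 : d v + f ⟨j, hjc⟩ * r = 0 :=
        (ExteriorAlgebra.algebraMap_leftInverse (Fin c → S)).injective
          (hdx.trans (map_zero _).symm)
      have hr : r ∈ Ideal.span (f '' {i | i.val < j}) := by
        refine hf ⟨j, hjc⟩ r ?_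
        rw [eq_neg_of_add_eq_zero_right h1]
        refine neg_mem ?_
        have : d v ∈ Ideal.span (f '' {i | i.val < j}) := by
          rw [← map_koszulForm_span]
          exact ⟨v, hv, rfl⟩
        exact this
      rw [← map_koszulForm_span] at hr
      obtain ⟨w, hw, hwr⟩ := hr
      refine ⟨ExteriorAlgebra.ι S w, ?_, ?_⟩
      · rw [truncTerm, zero_add, pow_one]
        exact ⟨w, hw, rfl⟩
      · rw [contraction_ι, hd, hwr]
    | succ q =>
      refine ih q b hb ?_
      have h := congrArg (contraction S c (LinearMap.proj ⟨j, hjc⟩)) hdx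
      have hdb := contraction_mem_truncTerm d j q b hb
      rw [map_add, map_sub, map_smul, map_zero, contraction_ι_mul,
        contraction_proj_eq_zero hjc _ _ (contraction_mem_truncTerm d j _ a ha),
        contraction_proj_eq_zero hjc _ _ hb,
        contraction_proj_eq_zero hjc _ _ hdb] at h
      simpa using h

theorem koszulD_exact (f : Fin c → S)
    (hf : ∀ j : Fin c, ∀ r : S,
      f j * r ∈ Ideal.span (f '' {i | i < j}) → r ∈ Ideal.span (f '' {i | i < j})) (q : ℕ) :
    Function.Exact (koszulD S c f (q + 2)) (koszulD S c f (q + 1)) := by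
  intro x
  constructor
  · intro hx
    obtain ⟨y, hy, hyx⟩ := exists_contraction_eq f hf c le_rfl q x
      (by rw [truncTerm_top]; exact x.2) (congrArg Subtype.val hx)
    rw [truncTerm_top] at hy
    exact ⟨⟨y, hy⟩, Subtype.ext hyx⟩
  · rintro ⟨y, rfl⟩
    exact Subtype.ext (CliffordAlgebra.contractLeft_contractLeft _ _)

theorem koszulD_eq_sum (f : Fin c → S) (q : ℕ) :
    koszulD S c f q = ∑ i, f i • koszulD S c (Pi.single i 1) q := by
  have hform : koszulForm S c f = ∑ i, f i • koszulForm S c (Pi.single i 1) := by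
    refine Finset.sum_congr rfl fun i _ => ?_
    congr 1
    ext k
    simp [koszulForm, Pi.single_apply]
  refine LinearMap.ext fun x => Subtype.ext ?_
  simp only [koszulD, LinearMap.sum_apply, LinearMap.smul_apply, AddSubmonoidClass.coe_finsetSum,
    Submodule.coe_smul, LinearMap.coe_restrict_apply]
  conv_lhs => rw [hform]
  rw [map_sum, LinearMap.sum_apply]
  simp only [map_smul, LinearMap.smul_apply]

theorem mem_smul_top_of_lTensor_koszulD_eq_zero (f : Fin c → S)
    (hf : ∀ j : Fin c, ∀ r : S,
      f j * r ∈ Ideal.span (f '' {i | i < j}) → r ∈ Ideal.span (f '' {i | i < j}))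
    (M : Type*) [AddCommGroup M] [Module S M] [Module.Flat S M] {q : ℕ} (hq : 1 ≤ q)
    (z : M ⊗[S] ↥(KoszulTerm S c q)) (hz : LinearMap.lTensor M (koszulD S c f q) z = 0) :
    z ∈ Ideal.span (Set.range f) • (⊤ : Submodule S (M ⊗[S] ↥(KoszulTerm S c q))) := by
  obtain ⟨q, rfl⟩ := Nat.exists_eq_add_of_le' hq
  obtain ⟨y, rfl⟩ := (Module.Flat.lTensor_exact M (koszulD_exact f hf q) z).mp hz
  rw [koszulD_eq_sum]
  have hsum : LinearMap.lTensor M (∑ i, f i • koszulD S c (Pi.single i 1) (q + 2)) y =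
      ∑ i, f i • LinearMap.lTensor M (koszulD S c (Pi.single i 1) (q + 2)) y := by
    rw [← LinearMap.coe_lTensorHom, map_sum, LinearMap.sum_apply]
    simp only [map_smul, LinearMap.smul_apply]
  rw [hsum]
  exact Submodule.sum_mem _ fun i _ =>
    Submodule.smul_mem_smul (Ideal.subset_span ⟨i, rfl⟩) Submodule.mem_top

end Acyclicity

/-- The difference of two systems agreeing below order `n` anticommutes with the zeroth map. -/
theorem anticomm_sub_of_agree {M : Type*} [AddCommGroup M] [Module S M] (T U : ℕ → M →ₗ[S] M)
    {n : ℕ} (hn : 1 ≤ n)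
    (hT : ∑ i ∈ Finset.range (n + 1), (T i).comp (T (n - i)) = 0)
    (hU : ∑ i ∈ Finset.range (n + 1), (U i).comp (U (n - i)) = 0)
    (hagree : ∀ i < n, T i = U i) :
    (T 0).comp (T n - U n) + (T n - U n).comp (T 0) = 0 := by
  obtain ⟨n, rfl⟩ := Nat.exists_eq_add_of_le' hn
  rw [Finset.sum_range_succ, Finset.sum_range_succ'] at hT hU
  have hmid : ∑ i ∈ Finset.range n, (T (i + 1)).comp (T (n + 1 - (i + 1))) =
      ∑ i ∈ Finset.range n, (U (i + 1)).comp (U (n + 1 - (i + 1))) := by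
    refine Finset.sum_congr rfl fun i hi => ?_
    have hi' := Finset.mem_range.mp hi
    rw [hagree (i + 1) (by omega), hagree (n + 1 - (i + 1)) (by omega)]
  have h0 : T 0 = U 0 := hagree 0 (by omega)
  rw [hmid] at hT
  simp only [Nat.sub_zero, Nat.sub_self] at hT hU
  rw [← h0] at hU
  have h := congrArg₂ (· - ·) hT hU
  simp only [sub_zero] at h
  rw [LinearMap.comp_sub, LinearMap.sub_comp, ← h]
  abel

theorem exists_incl_eq_of_eq (I : Ideal S) (p : ℕ) {a b : ℕ} (h : a = b)
    {y : G p ⊗[S] ↥(KoszulTerm S c a)}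
    (hy : y ∈ I • (⊤ : Submodule S (G p ⊗[S] ↥(KoszulTerm S c a)))) :
    ∃ y' ∈ I • (⊤ : Submodule S (G p ⊗[S] ↥(KoszulTerm S c b))),
      incl S c G p a y = incl S c G p b y' := by
  subst h
  exact ⟨y, hy, rfl⟩

/-- Two equivariant systems of higher CI operators that agree in all orders
`i < n` (for some `n ≥ 2`) agree modulo `I` in order `n`: the image of `t_n − u_n` on each
component `G_p ⊗ K_q` lies in `I·(G_{p−n} ⊗ K_{q+n−1})`; that is, the reductions `R ⊗ t_n`
and `R ⊗ u_n` over `R = S/I` coincide. -/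
theorem stmt7 {S : Type*} [CommRing S] {c : ℕ} (f : Fin c → S)
    (hreg : IsRegularSeq f)
    (G : ℕ → Type*) [∀ p, AddCommGroup (G p)] [∀ p, Module S (G p)]
    [∀ p, Module.Free S (G p)]
    (t1' : ∀ p, G (p + 1) →ₗ[S] G p)
    (hsq : ∀ p (x : G (p + 2)),
      t1' p (t1' (p + 1) x) ∈
        Ideal.span (Set.range f) • (⊤ : Submodule S (G p)))
    (T U : ℕ → TotalModule S c G →ₗ[S] TotalModule S c G)
    (hT : IsHigherCISystem S c G f t1' T) (hU : IsHigherCISystem S c G f t1' U)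
    (hTequiv : EquivariantSystem S c G T) (hUequiv : EquivariantSystem S c G U)
    (n : ℕ) (hn : 2 ≤ n)
    (hagree : ∀ i < n, T i = U i) :
    ∀ (p q : ℕ) (x : G p ⊗[S] ↥(KoszulTerm S c q)),
      ∃ y ∈ Ideal.span (Set.range f) •
          (⊤ : Submodule S (G (p - n) ⊗[S] ↥(KoszulTerm S c (q + n - 1)))),
        T n (incl S c G p q x) - U n (incl S c G p q x) =
          incl S c G (p - n) (q + n - 1) y := by
  intro p q x
  rcases lt_or_ge p n with hpn | hpn
  · exact ⟨0, zero_mem _, by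
      rw [hT.support n p q hpn, hU.support n p q hpn, sub_zero, map_zero]⟩
  have hone : (1 : ExteriorAlgebra S (Fin c → S)) ∈ KoszulTerm S c 0 :=
    Submodule.mem_one.mpr ⟨1, map_one _⟩
  have hanti := anticomm_sub_of_agree S T U (by omega) (hT.quadratic n) (hU.quadratic n) hagree
  have hmem : ∀ g : G p, proj S c G (p - n) (0 + n - 1)
      ((T n - U n) (incl S c G p 0 (g ⊗ₜ[S] ⟨1, hone⟩))) ∈ Ideal.span (Set.range f) •
        (⊤ : Submodule S (G (p - n) ⊗[S] ↥(KoszulTerm S c (0 + n - 1)))) := by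
    intro g
    refine mem_smul_top_of_lTensor_koszulD_eq_zero f hreg.1 _ (by omega) _ ?_
    have hzero : T 0 (incl S c G p 0 (g ⊗ₜ[S] ⟨1, hone⟩)) = 0 := by
      have hd : koszulD S c f 0 ⟨1, hone⟩ = 0 :=
        Subtype.ext (CliffordAlgebra.contractLeft_one (Q := 0) _)
      rw [hT.zeroth, LinearMap.lTensor_tmul, hd, TensorProduct.tmul_zero, smul_zero, map_zero]
    obtain ⟨z, hz⟩ : (T n - U n) (incl S c G p 0 (g ⊗ₜ[S] ⟨1, hone⟩)) ∈
        LinearMap.range (incl S c G (p - n) (0 + n - 1)) :=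
      sub_mem (hT.bidegree n p 0 hpn _) (hU.bidegree n p 0 hpn _)
    have h := LinearMap.congr_fun hanti (incl S c G p 0 (g ⊗ₜ[S] ⟨1, hone⟩))
    rw [LinearMap.add_apply, LinearMap.comp_apply, LinearMap.comp_apply, hzero, map_zero,
      add_zero, ← hz, hT.zeroth, LinearMap.zero_apply] at h
    have h' := congrArg (proj S c G (p - n) (0 + n - 1 - 1)) h
    rw [DirectSum.component.lof_self, map_zero] at h'
    rw [← hz, DirectSum.component.lof_self]
    have h'' := congrArg (((-1 : S) ^ (p - n)) • ·) h'
    simpa only [smul_smul, ← mul_pow, neg_one_mul, neg_neg, one_pow, one_smul, smul_zero]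
      using h''
  induction x using TensorProduct.induction_on with
  | zero => exact ⟨0, zero_mem _, by simp only [map_zero, sub_zero]⟩
  | add x y hx hy =>
    obtain ⟨x', hx', hx⟩ := hx
    obtain ⟨y', hy', hy⟩ := hy
    refine ⟨x' + y', add_mem hx' hy', ?_⟩
    rw [map_add, map_add, map_add, map_add, ← hx, ← hy]
    abel
  | tmul g η =>
    have hη : wedgeL S c q 0 η ⟨1, hone⟩ = η := Subtype.ext (mul_one _)
    have hTη := hTequiv n (by omega) p 0 q η g ⟨1, hone⟩
    have hUη := hUequiv n (by omega) p 0 q η g ⟨1, hone⟩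
    rw [hη] at hTη hUη
    have hmap : ∀ z ∈ Ideal.span (Set.range f) •
          (⊤ : Submodule S (G (p - n) ⊗[S] ↥(KoszulTerm S c (0 + n - 1)))),
        LinearMap.lTensor (G (p - n)) (wedgeL S c q (0 + n - 1) η) z ∈
          Ideal.span (Set.range f) • (⊤ : Submodule S
            (G (p - n) ⊗[S] ↥(KoszulTerm S c (q + (0 + n - 1))))) := by
      intro z hz
      have := Submodule.mem_map_of_mem
        (f := LinearMap.lTensor (G (p - n)) (wedgeL S c q (0 + n - 1) η)) hz
      rw [Submodule.map_smul''] at this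
      exact Submodule.smul_mono le_rfl le_top this
    obtain ⟨y, hy, hyeq⟩ := exists_incl_eq_of_eq S c G _ (p - n)
      (show q + (0 + n - 1) = q + n - 1 by omega) (hmap _ (hmem g))
    refine ⟨y, hy, ?_⟩
    rw [← hyeq, LinearMap.sub_apply, map_sub, map_sub, map_sub]
    exact congrArg₂ (· - ·) hTη hUη


end TorExtCI
end
end
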